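/- The von Mises stress-strain operator T_k is globally Lipschitz continuous on Sym(3): there exists a constant L ≥ 0 such that |T_k(ε₁) − T_k(ε₂)| ≤ L·|ε₁ − ε₂| for all ε₁, ε₂ ∈ Sym(3). -/

import Mathlib

open Matrix

/-- Frobenius inner product on 3×3 real matrices. -/
noncomputable def frob (σ τ : Matrix (Fin 3) (Fin 3) ℝ) : ℝ := ∑ i, ∑ j, σ i j * τ i j

/-- Frobenius norm. -/
noncomputable def fnorm (τ : Matrix (Fin 3) (Fin 3) ℝ) : ℝ := Real.sqrt (frob τ τ)

/-- Deviatoric part. -/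
noncomputable def devM (τ : Matrix (Fin 3) (Fin 3) ℝ) : Matrix (Fin 3) (Fin 3) ℝ :=
  τ - (Matrix.trace τ / 3) • (1 : Matrix (Fin 3) (Fin 3) ℝ)

/-- The isotropic elasticity tensor `ℂε = K tr(ε) I + 2G dev(ε)`. -/
noncomputable def Celast (K G : ℝ) (ε : Matrix (Fin 3) (Fin 3) ℝ) : Matrix (Fin 3) (Fin 3) ℝ :=
  (K * Matrix.trace ε) • (1 : Matrix (Fin 3) (Fin 3) ℝ) + (2 * G) • devM ε

/-- Trial deviatoric stress `s^tr(ε) = dev(ℂ(ε − εₖ₋₁ᵖ)) − βₖ₋₁`. -/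
noncomputable def strVM (K G : ℝ) (εp βp ε : Matrix (Fin 3) (Fin 3) ℝ) :
    Matrix (Fin 3) (Fin 3) ℝ :=
  devM (Celast K G (ε - εp)) - βp

/-- The von Mises stress-strain operator `T_k`: `T_k(ε) = σ^tr(ε)` if `|s^tr(ε)| ≤ Y`
and `T_k(ε) = σ^tr(ε) − (2G/(2G+a))(|s^tr(ε)| − Y) n^tr(ε)` otherwise. -/
noncomputable def TVM (K G a Y : ℝ) (εp βp ε : Matrix (Fin 3) (Fin 3) ℝ) :
    Matrix (Fin 3) (Fin 3) ℝ :=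
  if fnorm (strVM K G εp βp ε) ≤ Y then Celast K G (ε - εp)
  else Celast K G (ε - εp) -
    (2 * G / (2 * G + a) * (fnorm (strVM K G εp βp ε) - Y)) •
      ((fnorm (strVM K G εp βp ε))⁻¹ • strVM K G εp βp ε)

/-- The part of `s` exceeding the closed ball of radius `Y`, i.e. `s` minus its radial
projection onto that ball. -/
noncomputable def radialExcess {E : Type*} [NormedAddCommGroup E] [NormedSpace ℝ E]
    (Y : ℝ) (s : E) : E :=
  if ‖s‖ ≤ Y then 0 else (‖s‖ - Y) • (‖s‖⁻¹ • s)

section NormedSpace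

variable {E : Type*} [NormedAddCommGroup E] [NormedSpace ℝ E]

theorem norm_radialExcess_of_lt {Y : ℝ} (hY : 0 < Y) {s : E} (hs : Y < ‖s‖) :
    ‖radialExcess Y s‖ = ‖s‖ - Y := by
  have hs0 : ‖s‖ ≠ 0 := (hY.trans hs).ne'
  rw [radialExcess, if_neg hs.not_ge, norm_smul, norm_smul, norm_inv, norm_norm,
    inv_mul_cancel₀ hs0, mul_one, Real.norm_of_nonneg (sub_nonneg.2 hs.le)]

theorem norm_radialExcess_sub_le {Y : ℝ} (hY : 0 < Y) (s t : E) :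
    ‖radialExcess Y s - radialExcess Y t‖ ≤ 2 * ‖s - t‖ := by
  have hst := norm_sub_norm_le s t
  have hts := norm_sub_norm_le t s
  rw [norm_sub_rev t s] at hts
  rcases le_or_gt ‖s‖ Y with hs | hs <;> rcases le_or_gt ‖t‖ Y with ht | ht
  · simp [radialExcess, hs, ht]
  · rw [show radialExcess Y s = 0 from if_pos hs, zero_sub, norm_neg,
      norm_radialExcess_of_lt hY ht]
    linarith [norm_nonneg (s - t)]
  · rw [show radialExcess Y t = 0 from if_pos ht, sub_zero, norm_radialExcess_of_lt hY hs]
    linarith [norm_nonneg (s - t)]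
  · have hs0 : 0 < ‖s‖ := hY.trans hs
    have ht0 : 0 < ‖t‖ := hY.trans ht
    have hYs : Y / ‖s‖ ≤ 1 := (div_le_one hs0).2 hs.le
    have hYs0 : 0 ≤ Y / ‖s‖ := by positivity
    have hsplit : radialExcess Y s - radialExcess Y t =
        (1 - Y / ‖s‖) • (s - t) + (Y / ‖s‖ * (‖s‖ - ‖t‖)) • (‖t‖⁻¹ • t) := by
      rw [radialExcess, radialExcess, if_neg hs.not_ge, if_neg ht.not_ge]
      match_scalars <;> field_simp
      ring
    have hunit : ‖‖t‖⁻¹ • t‖ = 1 := by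
      rw [norm_smul, norm_inv, norm_norm, inv_mul_cancel₀ ht0.ne']
    calc ‖radialExcess Y s - radialExcess Y t‖
        ≤ (1 - Y / ‖s‖) * ‖s - t‖ + Y / ‖s‖ * |‖s‖ - ‖t‖| := by
          rw [hsplit]
          refine (norm_add_le _ _).trans_eq ?_
          rw [norm_smul, norm_smul _ (‖t‖⁻¹ • t), hunit, mul_one, norm_mul,
            Real.norm_of_nonneg (sub_nonneg.2 hYs), Real.norm_of_nonneg hYs0,
            Real.norm_eq_abs]
      _ ≤ 1 * ‖s - t‖ + 1 * ‖s - t‖ := by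
          gcongr
          · linarith
          · exact abs_norm_sub_norm_le s t
      _ = 2 * ‖s - t‖ := by ring

theorem exists_lipschitz_sub_smul_radialExcess [FiniteDimensional ℝ E] {Y : ℝ} (hY : 0 < Y)
    (A B : E →ₗ[ℝ] E) (c : ℝ) (p b : E) :
    ∃ L : ℝ, 0 ≤ L ∧ ∀ x y : E,
      ‖(A (x - p) - c • radialExcess Y (B (x - p) - b)) -
        (A (y - p) - c • radialExcess Y (B (y - p) - b))‖ ≤ L * ‖x - y‖ := by
  have hA := (LinearMap.toContinuousLinearMap A).le_opNorm
  have hB := (LinearMap.toContinuousLinearMap B).le_opNorm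
  simp only [LinearMap.coe_toContinuousLinearMap'] at hA hB
  set a := ‖LinearMap.toContinuousLinearMap A‖
  set d := ‖LinearMap.toContinuousLinearMap B‖
  refine ⟨a + |c| * (2 * d), by positivity, fun x y => ?_⟩
  have hAB : ∀ F : E →ₗ[ℝ] E, F (x - p) - F (y - p) = F (x - y) := fun F => by
    rw [← map_sub, sub_sub_sub_cancel_right]
  have hr := norm_radialExcess_sub_le hY (B (x - p) - b) (B (y - p) - b)
  rw [sub_sub_sub_cancel_right, hAB] at hr
  rw [sub_sub_sub_comm, hAB, ← smul_sub]
  calc _ ≤ ‖A (x - y)‖ +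
        |c| * ‖radialExcess Y (B (x - p) - b) - radialExcess Y (B (y - p) - b)‖ := by
        refine (norm_sub_le _ _).trans_eq ?_
        rw [norm_smul, Real.norm_eq_abs]
    _ ≤ a * ‖x - y‖ + |c| * (2 * (d * ‖x - y‖)) := by
        gcongr
        · exact hA _
        · exact hr.trans (by gcongr; exact hB _)
    _ = (a + |c| * (2 * d)) * ‖x - y‖ := by ring

end NormedSpace

/-- `devM` as a linear map. -/
noncomputable def devLinear : Matrix (Fin 3) (Fin 3) ℝ →ₗ[ℝ] Matrix (Fin 3) (Fin 3) ℝ where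
  toFun := devM
  map_add' x y := by
    simp only [devM, Matrix.trace_add]
    module
  map_smul' r x := by
    simp only [devM, Matrix.trace_smul, smul_eq_mul, RingHom.id_apply]
    module

/-- `Celast K G` as a linear map. -/
noncomputable def elastLinear (K G : ℝ) :
    Matrix (Fin 3) (Fin 3) ℝ →ₗ[ℝ] Matrix (Fin 3) (Fin 3) ℝ where
  toFun := Celast K G
  map_add' x y := by
    simp only [Celast, devM, Matrix.trace_add]
    module
  map_smul' r x := by
    simp only [Celast, devM, Matrix.trace_smul, smul_eq_mul, RingHom.id_apply]
    module

section Frobenius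

attribute [local instance] Matrix.frobeniusNormedAddCommGroup Matrix.frobeniusNormedSpace

theorem fnorm_eq_norm (τ : Matrix (Fin 3) (Fin 3) ℝ) : fnorm τ = ‖τ‖ := by
  rw [Matrix.frobenius_norm_def, ← Real.sqrt_eq_rpow]
  simp [fnorm, frob, sq]

theorem TVM_eq_sub_radialExcess (K G a Y : ℝ) (εp βp ε : Matrix (Fin 3) (Fin 3) ℝ) :
    TVM K G a Y εp βp ε = elastLinear K G (ε - εp) - (2 * G / (2 * G + a)) •
      radialExcess Y ((devLinear ∘ₗ elastLinear K G) (ε - εp) - βp) := by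
  have hs : (devLinear ∘ₗ elastLinear K G) (ε - εp) - βp = strVM K G εp βp ε := rfl
  have hC : elastLinear K G (ε - εp) = Celast K G (ε - εp) := rfl
  rw [hs, hC, TVM, radialExcess, fnorm_eq_norm]
  split_ifs
  · rw [smul_zero, sub_zero]
  · rw [mul_smul]

theorem exists_lipschitz_TVM (K G a : ℝ) {Y : ℝ} (hY : 0 < Y)
    (εp βp : Matrix (Fin 3) (Fin 3) ℝ) :
    ∃ L : ℝ, 0 ≤ L ∧ ∀ ε₁ ε₂ : Matrix (Fin 3) (Fin 3) ℝ,
      fnorm (TVM K G a Y εp βp ε₁ - TVM K G a Y εp βp ε₂) ≤ L * fnorm (ε₁ - ε₂) := by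
  simp only [fnorm_eq_norm, TVM_eq_sub_radialExcess]
  exact exists_lipschitz_sub_smul_radialExcess hY _ _ _ _ _

end Frobenius

/-- The von Mises stress-strain operator is globally Lipschitz continuous on `Sym(3)`. -/
theorem vonMises_lipschitz (K G a Y : ℝ) (hK : 0 < K) (hG : 0 < G) (ha : 0 < a)
    (hY : 0 < Y) (εp βp : Matrix (Fin 3) (Fin 3) ℝ) (hεp : εp.IsSymm) (hβp : βp.IsSymm)
    (hβtr : Matrix.trace βp = 0) :
    ∃ L : ℝ, 0 ≤ L ∧ ∀ ε₁ ε₂ : Matrix (Fin 3) (Fin 3) ℝ, ε₁.IsSymm → ε₂.IsSymm →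
      fnorm (TVM K G a Y εp βp ε₁ - TVM K G a Y εp βp ε₂) ≤ L * fnorm (ε₁ - ε₂) := by
  obtain ⟨L, hL, h⟩ := exists_lipschitz_TVM K G a hY εp βp
  exact ⟨L, hL, fun ε₁ ε₂ _ _ => h ε₁ ε₂⟩
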